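/- Suppose F_τ(t) ∼ A t^m e^{-C/t} and F_τ^{(k)}(t) ∼ B t^n e^{-C_k/t} as t → 0⁺, with A, B > 0, C_k > C > 0, m, n ∈ ℝ, and σ is gamma distributed with shape η > 0 and rate r > 0, independent of τ. If P(τ < σ) > 0 for all r > 0, then P(κ = k | τ < σ) ∼ ξ r^{(m-n)/2} e^{-2(√C_k - √C)√r} as r → ∞, where ξ = (B/A) · C_k^{(2n+2η-1)/4} / C^{(2m+2η-1)/4}. -/

import Mathlib

open MeasureTheory ProbabilityTheory Real Filter Set Topology

lemma abs_le_abs_sinh (u : ℝ) : |u| ≤ |sinh u| := by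
  rw [abs_sinh]
  exact self_le_sinh_iff.2 (abs_nonneg u)

lemma abs_le_abs_two_mul_sinh_div {b : ℝ} (hb : 0 < b) (y : ℝ) :
    |y| ≤ |2 * b * sinh (y / (2 * b))| := by
  have h := abs_le_abs_sinh (y / (2 * b))
  rw [abs_div, div_le_iff₀ (by positivity)] at h
  rw [abs_mul]
  linarith

lemma tendsto_mul_sinh_div (y : ℝ) :
    Tendsto (fun b : ℝ => 2 * b * sinh (y / (2 * b))) atTop (𝓝 y) := by
  have h1 : HasDerivAt (fun u : ℝ => sinh (y * u)) y 0 := by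
    have := ((hasDerivAt_id (0 : ℝ)).const_mul y).sinh
    simpa using this
  have h2 : Tendsto (fun b : ℝ => (2 * b)⁻¹) atTop (𝓝[≠] 0) := by
    refine tendsto_nhdsWithin_iff.2 ⟨?_, ?_⟩
    · exact tendsto_inv_atTop_zero.comp (tendsto_id.const_mul_atTop (by norm_num))
    · filter_upwards [eventually_gt_atTop 0] with b hb
      simp only [mem_compl_iff, mem_singleton_iff]
      positivity
  have h3 := (hasDerivAt_iff_tendsto_slope_zero.1 h1).comp h2
  refine h3.congr fun b => ?_
  simp [div_eq_mul_inv]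

/-- Laplace's method around a saddle point, after the substitution `s = a e^{y/b}`. -/
lemma tendsto_integral_saddle {ι : Type*} {l : Filter ι} [l.IsCountablyGenerated]
    {H : ℝ → ℝ} {L M p q : ℝ} (hHm : Measurable H) (hH : Tendsto H (𝓝[>] 0) (𝓝 L))
    (hq : 0 ≤ q) (hM : 0 ≤ M) (hbound : ∀ s > 0, |H s| ≤ M * (1 + s ^ q))
    {a b : ι → ℝ} (ha : Tendsto a l (𝓝[>] 0)) (hb : Tendsto b l atTop) :
    Tendsto (fun r => ∫ y, exp (p * (y / b r)) *
      exp (-(2 * b r * sinh (y / (2 * b r))) ^ 2) * H (a r * exp (y / b r))) l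
      (𝓝 (L * √π)) := by
  have hlim : L * √π = ∫ y : ℝ, exp (-y ^ 2) * L := by
    have := integral_gaussian 1
    simp only [neg_mul, one_mul, div_one] at this
    rw [integral_mul_const, this, mul_comm]
  rw [hlim]
  have ha0 : Tendsto a l (𝓝 0) := ha.mono_right nhdsWithin_le_nhds
  have hapos : ∀ᶠ r in l, 0 < a r := ha self_mem_nhdsWithin
  refine tendsto_integral_filter_of_dominated_convergence
    (fun y => 2 * M * exp ((|p| + q) ^ 2 / 2) * exp (-(1 / 2) * y ^ 2)) ?_ ?_ ?_ ?_
  · refine Eventually.of_forall fun r => Measurable.aestronglyMeasurable ?_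
    have h1 : Measurable fun y : ℝ => H (a r * exp (y / b r)) := hHm.comp (by fun_prop)
    have h2 : Measurable fun y : ℝ => sinh (y / (2 * b r)) :=
      continuous_sinh.measurable.comp (by fun_prop)
    fun_prop
  · filter_upwards [hapos, ha0.eventually_le_const zero_lt_one, hb.eventually_ge_atTop 1]
      with r hr0 hr1 hb1
    refine Eventually.of_forall fun y => ?_
    have hb0 : 0 < b r := by linarith
    have hyb : |y / b r| ≤ |y| := by
      rw [abs_div, abs_of_pos hb0]
      exact div_le_self (abs_nonneg y) hb1
    have e1 : exp (p * (y / b r)) ≤ exp (|p| * |y|) := by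
      refine exp_le_exp.2 ((le_abs_self _).trans ?_)
      rw [abs_mul]
      gcongr
    have e2 : exp (-(2 * b r * sinh (y / (2 * b r))) ^ 2) ≤ exp (-y ^ 2) :=
      exp_le_exp.2 (neg_le_neg (sq_le_sq.2 (abs_le_abs_two_mul_sinh_div hb0 y)))
    have e3 : |H (a r * exp (y / b r))| ≤ 2 * M * exp (q * |y|) := by
      have hs : a r * exp (y / b r) ≤ exp |y| :=
        calc a r * exp (y / b r) ≤ 1 * exp |y| := by
              gcongr
              exact (le_abs_self _).trans hyb
          _ = exp |y| := one_mul _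
      have hs2 : (a r * exp (y / b r)) ^ q ≤ exp (q * |y|) := by
        calc (a r * exp (y / b r)) ^ q ≤ (exp |y|) ^ q := by gcongr
          _ = exp (q * |y|) := by rw [← exp_mul, mul_comm]
      have hs3 : 1 ≤ exp (q * |y|) := one_le_exp (by positivity)
      calc |H (a r * exp (y / b r))| ≤ M * (1 + (a r * exp (y / b r)) ^ q) :=
            hbound _ (by positivity)
        _ ≤ M * (exp (q * |y|) + exp (q * |y|)) := by gcongr
        _ = _ := by ring
    calc ‖exp (p * (y / b r)) * exp (-(2 * b r * sinh (y / (2 * b r))) ^ 2) *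
          H (a r * exp (y / b r))‖
        = exp (p * (y / b r)) * exp (-(2 * b r * sinh (y / (2 * b r))) ^ 2) *
          |H (a r * exp (y / b r))| := by simp
      _ ≤ exp (|p| * |y|) * exp (-y ^ 2) * (2 * M * exp (q * |y|)) := by gcongr
      _ = 2 * M * exp (|p| * |y| + -y ^ 2 + q * |y|) := by rw [exp_add, exp_add]; ring
      _ ≤ 2 * M * exp ((|p| + q) ^ 2 / 2 + -(1 / 2) * y ^ 2) := by
          refine mul_le_mul_of_nonneg_left (exp_le_exp.2 ?_) (by positivity)
          nlinarith [sq_nonneg (|p| + q - |y|), sq_abs y]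
      _ = _ := by rw [exp_add]; ring
  · exact (integrable_exp_neg_mul_sq (by norm_num)).const_mul _
  · refine Eventually.of_forall fun y => ?_
    have hyb : Tendsto (fun r => y / b r) l (𝓝 0) := hb.const_div_atTop y
    have t1 : Tendsto (fun r => exp (p * (y / b r))) l (𝓝 1) := by
      have := (hyb.const_mul p).rexp
      simpa using this
    have t2 : Tendsto (fun r => exp (-(2 * b r * sinh (y / (2 * b r))) ^ 2)) l
        (𝓝 (exp (-y ^ 2))) :=
      (((tendsto_mul_sinh_div y).comp hb).pow 2).neg.rexp
    have t3 : Tendsto (fun r => a r * exp (y / b r)) l (𝓝[>] 0) := by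
      refine tendsto_nhdsWithin_iff.2 ⟨?_, ?_⟩
      · have := ha0.mul hyb.rexp
        simpa using this
      · filter_upwards [hapos] with r hr
        exact mul_pos hr (exp_pos _)
    have := (t1.mul t2).mul (hH.comp t3)
    simpa using this

lemma setIntegral_Ioi_eq_integral_exp {a b : ℝ} (ha : 0 < a) (hb : 0 < b) (f : ℝ → ℝ) :
    ∫ s in Ioi 0, f s = ∫ y, a * exp (y / b) / b * f (a * exp (y / b)) := by
  have himg : (fun y : ℝ => a * exp (y / b)) '' univ = Ioi 0 := by
    ext s
    simp only [image_univ, mem_range, mem_Ioi]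
    constructor
    · rintro ⟨y, rfl⟩
      positivity
    · intro hs
      refine ⟨b * log (s / a), ?_⟩
      rw [mul_div_cancel_left₀ _ hb.ne', exp_log (by positivity)]
      field_simp
  have hder : ∀ x ∈ (univ : Set ℝ),
      HasDerivWithinAt (fun y : ℝ => a * exp (y / b)) (a * exp (x / b) / b) univ x := by
    intro x _
    refine HasDerivAt.hasDerivWithinAt
      ((((hasDerivAt_id' x).div_const b).exp.const_mul a).congr_deriv ?_)
    ring
  have hinj : InjOn (fun y : ℝ => a * exp (y / b)) univ := by
    intro x _ y _ hxy
    have h1 := exp_injective (mul_left_cancel₀ ha.ne' hxy)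
    field_simp at h1
    exact h1
  rw [← himg, integral_image_eq_integral_abs_deriv_smul MeasurableSet.univ hder hinj,
    setIntegral_univ]
  refine integral_congr_ae (Eventually.of_forall fun y => ?_)
  have : 0 < a * exp (y / b) / b := by positivity
  simp only [smul_eq_mul, abs_of_pos this]

/-- A bounded function comparable to `A t^m e^{-C/t}` near `0` is dominated by
`t^m e^{-C/t}` up to a constant and a polynomial factor on the whole half-line. -/
lemma exists_abs_div_le {G : ℝ → ℝ} {A C m : ℝ} (hC : 0 < C)
    (hG1 : ∀ s, |G s| ≤ 1)
    (hG : Tendsto (fun t => G t / (t ^ m * exp (-C / t))) (𝓝[>] 0) (𝓝 A)) :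
    ∃ M, 0 ≤ M ∧ ∀ s > 0, |G s / (s ^ m * exp (-C / s))| ≤ M * (1 + s ^ |m|) := by
  have hev : ∀ᶠ t in 𝓝[>] (0 : ℝ), |G t / (t ^ m * exp (-C / t))| < |A| + 1 :=
    hG.abs.eventually_lt_const (by linarith)
  obtain ⟨δ, hδ, hsub⟩ := mem_nhdsGT_iff_exists_Ioo_subset.1 hev
  have hδ0 : (0 : ℝ) < δ := hδ
  refine ⟨|A| + 1 + exp (C / δ) * (1 + δ ^ (-m)), by positivity, fun s hs => ?_⟩
  have hsm : 0 ≤ s ^ |m| := by positivity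
  rcases lt_or_ge s δ with h | h
  · have h1 : |G s / (s ^ m * exp (-C / s))| < |A| + 1 := hsub ⟨hs, h⟩
    have h2 : 0 ≤ exp (C / δ) * (1 + δ ^ (-m)) := by positivity
    nlinarith [abs_nonneg A]
  · have h1 : |G s / (s ^ m * exp (-C / s))| ≤ s ^ (-m) * exp (C / s) := by
      rw [abs_div, abs_of_pos (show 0 < s ^ m * exp (-C / s) by positivity), rpow_neg hs.le,
        div_le_iff₀ (by positivity), neg_div, exp_neg]
      have : (s ^ m)⁻¹ * exp (C / s) * (s ^ m * (exp (C / s))⁻¹) = 1 := by field_simp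
      rw [this]
      exact hG1 s
    have h2 : exp (C / s) ≤ exp (C / δ) := by gcongr
    have h3 : s ^ (-m) ≤ (1 + δ ^ (-m)) * (1 + s ^ |m|) := by
      have hδm : 0 ≤ δ ^ (-m) := by positivity
      rcases le_or_gt 0 m with hm | hm
      · have : s ^ (-m) ≤ δ ^ (-m) := rpow_le_rpow_of_nonpos hδ0 h (by linarith)
        nlinarith
      · rw [abs_of_neg hm] at hsm ⊢
        nlinarith
    calc |G s / (s ^ m * exp (-C / s))| ≤ s ^ (-m) * exp (C / s) := h1
      _ ≤ ((1 + δ ^ (-m)) * (1 + s ^ |m|)) * exp (C / δ) := by gcongr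
      _ ≤ _ := by
        have hA : 0 ≤ (|A| + 1) * (1 + s ^ |m|) := by positivity
        nlinarith

/-- Small-time asymptotics `G t ∼ A t^m e^{-C/t}` determine the large-rate asymptotics of the
Laplace transform of `s^(η-1) G s`. -/
lemma tendsto_laplace_div {G : ℝ → ℝ} {A C m η : ℝ} (hA : 0 < A) (hC : 0 < C)
    (hGm : Measurable G) (hG1 : ∀ s, |G s| ≤ 1)
    (hG : Tendsto (fun t => G t / (A * t ^ m * exp (-C / t))) (𝓝[>] 0) (𝓝 1)) :
    Tendsto (fun r => (∫ s in Ioi 0, s ^ (η - 1) * exp (-(r * s)) * G s) /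
      (A * C ^ ((2 * m + 2 * η - 1) / 4) * r ^ (-(2 * m + 2 * η + 1) / 4) *
        exp (-2 * √C * √r))) atTop (𝓝 (√π)) := by
  set H : ℝ → ℝ := fun t => G t / (t ^ m * exp (-C / t)) with hHdef
  have hH : Tendsto H (𝓝[>] 0) (𝓝 A) := by
    have := hG.const_mul A
    rw [mul_one] at this
    refine this.congr fun t => ?_
    simp only [hHdef]
    field_simp
  obtain ⟨M, hM, hbound⟩ := exists_abs_div_le hC hG1 hH
  have hHm : Measurable H := by fun_prop
  have ha : Tendsto (fun r : ℝ => (C / r) ^ (1 / 2 : ℝ)) atTop (𝓝[>] 0) := by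
    refine tendsto_nhdsWithin_iff.2 ⟨?_, ?_⟩
    · have := (tendsto_id.const_div_atTop C : Tendsto (fun r : ℝ => C / r) atTop (𝓝 0)).rpow_const
        (p := 1 / 2) (Or.inr (by norm_num))
      simpa using this
    · filter_upwards [eventually_gt_atTop 0] with r hr
      exact rpow_pos_of_pos (by positivity) _
  have hb : Tendsto (fun r : ℝ => (C * r) ^ (1 / 4 : ℝ)) atTop atTop :=
    (tendsto_rpow_atTop (by norm_num)).comp (tendsto_id.const_mul_atTop hC)
  have key :=
    (tendsto_integral_saddle (p := m + η) hHm hH (abs_nonneg m) hM hbound ha hb).div_const A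
  rw [mul_div_cancel_left₀ _ hA.ne'] at key
  refine key.congr' ?_
  filter_upwards [eventually_gt_atTop 0] with r hr
  set a := (C / r) ^ (1 / 2 : ℝ) with hadef
  set b := (C * r) ^ (1 / 4 : ℝ) with hbdef
  have ha0 : 0 < a := by positivity
  have hb0 : 0 < b := by positivity
  have hbb : b ^ 2 = √C * √r := by
    rw [hbdef, ← rpow_natCast, ← rpow_mul (by positivity), ← sqrt_mul hC.le, sqrt_eq_rpow]
    norm_num
  have hsa : a = √C / √r := by
    rw [hadef, ← sqrt_eq_rpow, sqrt_div hC.le]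
  have hra : r * a = b ^ 2 := by
    rw [hbb, hsa]
    nth_rewrite 1 [← mul_self_sqrt hr.le]
    field_simp
  have hCa : C / a = b ^ 2 := by
    rw [hbb, hsa]
    nth_rewrite 1 [← mul_self_sqrt hC.le]
    field_simp
  have hint : ∫ s in Ioi 0, s ^ (η - 1) * exp (-(r * s)) * G s =
      a ^ (m + η) / b * exp (-2 * b ^ 2) * ∫ y, exp ((m + η) * (y / b)) *
        exp (-(2 * b * sinh (y / (2 * b))) ^ 2) * H (a * exp (y / b)) := by
    rw [setIntegral_Ioi_eq_integral_exp ha0 hb0, ← integral_const_mul]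
    refine integral_congr_ae (Eventually.of_forall fun y => ?_)
    dsimp only
    set s := a * exp (y / b) with hs
    have hs0 : 0 < s := by positivity
    have hGs : G s = s ^ m * exp (-C / s) * H s := by
      simp only [hHdef]
      field_simp
    have hsp : s / b * (s ^ (η - 1) * s ^ m) = a ^ (m + η) / b * exp ((m + η) * (y / b)) := by
      have h1 : s * (s ^ (η - 1) * s ^ m) = s ^ (m + η) := by
        nth_rewrite 1 [← rpow_one s]
        rw [← rpow_add hs0, ← rpow_add hs0]
        ring_nf
      have h2 : s ^ (m + η) = a ^ (m + η) * exp ((m + η) * (y / b)) := by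
        rw [hs, mul_rpow ha0.le (exp_pos _).le, ← exp_mul, mul_comm (y / b)]
      rw [div_mul_eq_mul_div, h1, h2]
      ring
    have hexp : exp (-(r * s)) * exp (-C / s) =
        exp (-2 * b ^ 2) * exp (-(2 * b * sinh (y / (2 * b))) ^ 2) := by
      rw [← exp_add, ← exp_add]
      congr 1
      have h1 : r * s = b ^ 2 * exp (y / b) := by rw [hs, ← mul_assoc, hra]
      have h2 : C / s = b ^ 2 * exp (-(y / b)) := by
        rw [hs, exp_neg, ← div_div, hCa, div_eq_mul_inv]
      have h3 : y / b = y / (2 * b) + y / (2 * b) := by field_simp; ring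
      rw [neg_div, h1, h2, sinh_eq, h3, neg_add, exp_add, exp_add]
      have h4 : exp (y / (2 * b)) * exp (-(y / (2 * b))) = 1 := by rw [← exp_add]; simp
      linear_combination (-2 * b ^ 2) * h4
    rw [hGs]
    linear_combination (exp (-(r * s)) * exp (-C / s) * H s) * hsp +
      (a ^ (m + η) / b * exp ((m + η) * (y / b)) * H s) * hexp
  have hpow : a ^ (m + η) / b =
      C ^ ((2 * m + 2 * η - 1) / 4) * r ^ (-(2 * m + 2 * η + 1) / 4) := by
    rw [hadef, hbdef, ← rpow_mul (by positivity), div_rpow hC.le hr.le, mul_rpow hC.le hr.le,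
      div_div, mul_left_comm, ← div_div, ← rpow_sub hC, ← rpow_add hr, div_eq_mul_inv,
      ← rpow_neg hr.le]
    ring_nf
  rw [hint, hpow, hbb, mul_assoc (-2 : ℝ)]
  have : 0 < C ^ ((2 * m + 2 * η - 1) / 4) := by positivity
  have : 0 < r ^ (-(2 * m + 2 * η + 1) / 4) := by positivity
  field_simp

/-- Conditioning on an independent gamma time. -/
lemma toReal_measure_lt_gamma {Ω : Type*} [MeasurableSpace Ω] {μ : Measure Ω}
    [IsProbabilityMeasure μ] {τ : Ω → ℝ} {κ : Ω → ℕ} {σ : Ω → ℝ} {η r : ℝ}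
    (hτ : Measurable τ) (hκ : Measurable κ) (hσ : Measurable σ) (hη : 0 < η) (hr : 0 < r)
    (hdist : μ.map σ = gammaMeasure η r) (hindep : IndepFun (fun ω => (τ ω, κ ω)) σ μ)
    (T : Set ℕ) :
    (μ {ω | τ ω < σ ω ∧ κ ω ∈ T}).toReal = r ^ η / Gamma η *
      ∫ s in Ioi 0, s ^ (η - 1) * exp (-(r * s)) * (μ {ω | τ ω ≤ s ∧ κ ω ∈ T}).toReal := by
  have hDm : MeasurableSet {x : (ℝ × ℕ) × ℝ | x.1.1 < x.2 ∧ x.1.2 ∈ T} := by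
    have h1 : MeasurableSet {x : (ℝ × ℕ) × ℝ | x.1.1 < x.2} :=
      measurableSet_lt (by fun_prop) (by fun_prop)
    have h2 : MeasurableSet {x : (ℝ × ℕ) × ℝ | x.1.2 ∈ T} :=
      (measurable_snd.comp measurable_fst) (MeasurableSet.of_discrete (s := T))
    exact h1.inter h2
  have hmono : Monotone fun s : ℝ => μ {ω | τ ω < s ∧ κ ω ∈ T} := fun s t hst =>
    measure_mono fun ω h => ⟨h.1.trans_le hst, h.2⟩
  have hX : Measurable fun ω => (τ ω, κ ω) := hτ.prodMk hκ
  have hμ : μ {ω | τ ω < σ ω ∧ κ ω ∈ T} =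
      ∫⁻ s, μ {ω | τ ω < s ∧ κ ω ∈ T} ∂(gammaMeasure η r) := by
    have := isProbabilityMeasure_gammaMeasure hη hr
    have h1 : μ {ω | τ ω < σ ω ∧ κ ω ∈ T} =
        (μ.map (fun ω => ((τ ω, κ ω), σ ω))) {x | x.1.1 < x.2 ∧ x.1.2 ∈ T} := by
      rw [Measure.map_apply (hX.prodMk hσ) hDm]
      rfl
    rw [h1, (indepFun_iff_map_prod_eq_prod_map_map hX.aemeasurable hσ.aemeasurable).1 hindep,
      hdist, Measure.prod_apply_symm hDm]
    refine lintegral_congr fun s => ?_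
    rw [Measure.map_apply hX (measurable_prodMk_right hDm)]
    rfl
  have hlt : ∀ᵐ s : ℝ, μ {ω | τ ω ≤ s ∧ κ ω ∈ T} = μ {ω | τ ω < s ∧ κ ω ∈ T} := by
    have h : Set.Countable {t : ℝ | μ.restrict {ω | κ ω ∈ T} {ω | τ ω ≤ t} ≠
        μ.restrict {ω | κ ω ∈ T} {ω | τ ω < t}} :=
      countable_meas_le_ne_meas_lt (R := ℝᵒᵈ) (μ.restrict {ω | κ ω ∈ T})
        (fun ω => OrderDual.toDual (τ ω))
    filter_upwards [measure_eq_zero_iff_ae_notMem.1 (h.measure_zero volume)] with s hs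
    replace hs := not_not.1 hs
    rw [Measure.restrict_apply (measurableSet_le hτ measurable_const),
      Measure.restrict_apply (measurableSet_lt hτ measurable_const)] at hs
    exact hs
  have hpdf : Measurable (gammaPDF η r) := (measurable_gammaPDFReal η r).ennreal_ofReal
  rw [hμ, ← integral_toReal hmono.measurable.aemeasurable (ae_of_all _ fun _ => measure_lt_top _ _),
    gammaMeasure, integral_withDensity_eq_integral_toReal_smul hpdf
      (ae_of_all _ fun _ => ENNReal.ofReal_lt_top), ← integral_const_mul,
    ← integral_indicator measurableSet_Ioi]
  refine integral_congr_ae ?_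
  filter_upwards [hlt, Measure.ae_ne volume (0 : ℝ)] with s hs hs0
  simp only [gammaPDF, smul_eq_mul, ENNReal.toReal_ofReal (gammaPDFReal_nonneg hη hr s), ← hs]
  rcases lt_or_gt_of_ne hs0 with h | h
  · simp [gammaPDFReal, h.not_ge, h.le]
  · simp only [gammaPDFReal, h.le, if_true, indicator_of_mem (mem_Ioi.2 h)]
    ring

/-- Conditional hitting probability asymptotics under gamma-distributed resetting:
if `F_τ(t) ∼ A t^m e^{-C/t}` and `F_τ^{(k)}(t) ∼ B t^n e^{-C_k/t}` as `t → 0⁺`, and `σ_r`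
is gamma with shape `η` and rate `r`, independent of `(τ, κ)`, then
`P(κ = k | τ < σ_r) ∼ ξ r^{(m-n)/2} e^{-2(√C_k-√C)√r}` as `r → ∞`, where
`ξ = (B/A) C_k^{(2n+2η-1)/4} / C^{(2m+2η-1)/4}`. -/
theorem conditional_hitting_gamma
    {Ω : Type*} [MeasurableSpace Ω] (μ : Measure Ω) [IsProbabilityMeasure μ]
    (τ : Ω → ℝ) (κ : Ω → ℕ) (k : ℕ) (σ : ℝ → Ω → ℝ)
    (hτ : Measurable τ) (hκ : Measurable κ) (hσ : ∀ r, Measurable (σ r))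
    (hτpos : ∀ᵐ ω ∂μ, 0 < τ ω)
    (A B C Ck m n η : ℝ)
    (hA : 0 < A) (hB : 0 < B) (hC : 0 < C) (hCk : C < Ck) (hη : 0 < η)
    (hdist : ∀ r > 0, Measure.map (σ r) μ = gammaMeasure η r)
    (hindep : ∀ r > 0, IndepFun (fun ω => (τ ω, κ ω)) (σ r) μ)
    (hF : Tendsto (fun t => (μ {ω | τ ω ≤ t}).toReal /
        (A * t ^ m * Real.exp (-C / t))) (𝓝[>] 0) (𝓝 1))
    (hFk : Tendsto (fun t => (μ {ω | τ ω ≤ t ∧ κ ω = k}).toReal /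
        (B * t ^ n * Real.exp (-Ck / t))) (𝓝[>] 0) (𝓝 1))
    (hppos : ∀ r > 0, 0 < (μ {ω | τ ω < σ r ω}).toReal)
    (hpkpos : ∀ r > 0, 0 < (μ {ω | κ ω = k ∧ τ ω < σ r ω}).toReal) :
    Tendsto (fun r : ℝ =>
        ((μ {ω | κ ω = k ∧ τ ω < σ r ω}).toReal / (μ {ω | τ ω < σ r ω}).toReal) /
          ((B / A * (Ck ^ ((2 * n + 2 * η - 1) / 4) / C ^ ((2 * m + 2 * η - 1) / 4))) *
            r ^ ((m - n) / 2) *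
            Real.exp (-2 * (Real.sqrt Ck - Real.sqrt C) * Real.sqrt r)))
      atTop (𝓝 1) := by
  have hCk0 : 0 < Ck := hC.trans hCk
  have hmeas : ∀ T : Set ℕ, Measurable fun s : ℝ => (μ {ω | τ ω ≤ s ∧ κ ω ∈ T}).toReal :=
    fun T => Measurable.ennreal_toReal (Monotone.measurable fun s t hst =>
      measure_mono fun ω h => ⟨h.1.trans hst, h.2⟩)
  have hle : ∀ T : Set ℕ, ∀ s : ℝ, |(μ {ω | τ ω ≤ s ∧ κ ω ∈ T}).toReal| ≤ 1 := fun T s => by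
    rw [abs_of_nonneg ENNReal.toReal_nonneg]
    exact measureReal_le_one
  have h1 := tendsto_laplace_div (η := η) hA hC (hmeas univ) (hle univ) (by simpa using hF)
  have h2 := tendsto_laplace_div (η := η) hB hCk0 (hmeas {k}) (hle {k}) (by simpa using hFk)
  have hπ : √π ≠ 0 := (sqrt_pos.2 pi_pos).ne'
  have h3 := h2.div h1 hπ
  rw [div_self hπ] at h3
  refine h3.congr' ?_
  filter_upwards [eventually_gt_atTop 0] with r hr
  have e1 := toReal_measure_lt_gamma hτ hκ (hσ r) hη hr (hdist r hr) (hindep r hr) univ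
  have e2 := toReal_measure_lt_gamma hτ hκ (hσ r) hη hr (hdist r hr) (hindep r hr) {k}
  have hset : {ω | κ ω = k ∧ τ ω < σ r ω} = {ω | τ ω < σ r ω ∧ κ ω ∈ ({k} : Set ℕ)} := by
    ext ω
    simp [and_comm]
  have hset1 : {ω | τ ω < σ r ω} = {ω | τ ω < σ r ω ∧ κ ω ∈ (univ : Set ℕ)} := by simp
  have hp := hppos r hr
  rw [hset1, e1] at hp
  rw [hset, hset1, e1, e2]
  have hc : 0 < r ^ η / Gamma η := div_pos (by positivity) (Gamma_pos_of_pos hη)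
  have hI := (pos_of_mul_pos_right hp hc.le)
  have hr1 : r ^ (-(2 * n + 2 * η + 1) / 4) =
      r ^ ((m - n) / 2) * r ^ (-(2 * m + 2 * η + 1) / 4) := by
    rw [← rpow_add hr]
    ring_nf
  have hr2 : exp (-2 * √Ck * √r) = exp (-2 * (√Ck - √C) * √r) * exp (-2 * √C * √r) := by
    rw [← exp_add]
    ring_nf
  simp only [Pi.div_apply]
  rw [hr1, hr2, mul_div_mul_left _ _ hc.ne']
  have : 0 < r ^ ((m - n) / 2) := by positivity
  have : 0 < r ^ (-(2 * m + 2 * η + 1) / 4) := by positivity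
  have : 0 < C ^ ((2 * m + 2 * η - 1) / 4) := by positivity
  have : 0 < Ck ^ ((2 * n + 2 * η - 1) / 4) := by positivity
  field_simp
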